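/- Let p(X) = X⁷ − 23X⁴ − 28X³ − 33X² − 17X + 1, let K = ℚ[X]/(p(X)) with θ the image of X, let 𝒰 = 𝒪_K^× be the unit group of the ring of integers of K, and let f₁, f₂, f₃, f₄ be the rational polynomials given in the context. Then the units f₁(θ), f₂(θ), f₃(θ), f₄(θ) and −1 generate 𝒰 modulo squares: the subgroup of 𝒰 generated by f₁(θ), f₂(θ), f₃(θ), f₄(θ), −1 together with the subgroup of squares {u² : u ∈ 𝒰} is all of 𝒰. -/

import Mathlib

open Polynomial NumberField

/-- The polynomial `p(X) = X⁷ − 23X⁴ − 28X³ − 33X² − 17X + 1` over `ℚ`. -/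
noncomputable def pQ : Polynomial ℚ :=
  X ^ 7 - 23 * X ^ 4 - 28 * X ^ 3 - 33 * X ^ 2 - 17 * X + 1

noncomputable def f₁ : Polynomial ℚ := X

noncomputable def f₂ : Polynomial ℚ :=
  C (1/3 : ℚ) * (38 * X ^ 6 + 2 * X ^ 5 - X ^ 4 - 872 * X ^ 3
    - 1108 * X ^ 2 - 1309 * X - 713)

noncomputable def f₃ : Polynomial ℚ :=
  C (1/3 : ℚ) * (842 * X ^ 6 + 5072 * X ^ 5 - 6847 * X ^ 4 - 46061 * X ^ 3
    - 34930 * X ^ 2 - 52216 * X + 2878)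

noncomputable def f₄ : Polynomial ℚ :=
  C (1/3 : ℚ) * (4260971 * X ^ 6 - 3124108 * X ^ 5 + 2290532 * X ^ 4
    - 99681839 * X ^ 3 - 46221667 * X ^ 2 - 106722952 * X + 5811547)

theorem isSquare_of_map_eq_one {G ι κ : Type*} [CommGroup G] [Fintype ι] [Fintype κ]
    (b : ι → G) (hb : Subgroup.closure (Set.range b) = ⊤)
    (χ : G →* (κ → ℤˣ)) (hχ : Function.Surjective χ)
    (hcard : Fintype.card ι ≤ Fintype.card κ) {x : G} (hx : χ x = 1) : IsSquare x := by
  classical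
  have key (y : G) : ∃ (s : ι → Fin 2) (z : G), y = (∏ i, b i ^ (s i : ℕ)) * z ^ 2 := by
    obtain ⟨a, ha⟩ := Subgroup.exists_of_mem_closure_range b y (hb ▸ Subgroup.mem_top y)
    refine ⟨fun i => ⟨(a i % 2).toNat, by omega⟩, ∏ i, b i ^ (a i / 2), ?_⟩
    rw [ha, ← Finset.prod_pow, ← Finset.prod_mul_distrib]
    refine Finset.prod_congr rfl fun i _ => ?_
    rw [← zpow_natCast, ← zpow_natCast, ← zpow_mul, ← zpow_add]
    congr 1
    dsimp only
    omega
  have hsq (z : G) : χ (z ^ 2) = 1 := by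
    ext j; simp
  let Φ : (ι → Fin 2) → (κ → ℤˣ) := fun s => χ (∏ i, b i ^ (s i : ℕ))
  have hsurj : Function.Surjective Φ := fun t => by
    obtain ⟨y, rfl⟩ := hχ t
    obtain ⟨s, z, rfl⟩ := key y
    exact ⟨s, by simp only [Φ]; rw [map_mul, hsq, mul_one]⟩
  have hinj : Function.Injective Φ := by
    refine (hsurj.bijective_of_nat_card_le ?_).1
    simpa using Nat.pow_le_pow_right two_pos hcard
  obtain ⟨s, z, rfl⟩ := key x
  rw [map_mul, hsq, mul_one] at hx
  have hs : s = 0 := hinj (hx.trans (by simp [Φ]))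
  exact ⟨z, by simp [hs, sq]⟩

theorem closure_union_squares_eq_top {G ι κ : Type*} [CommGroup G] [Fintype ι] [Fintype κ]
    [DecidableEq κ] (b : ι → G)
    (hb : Subgroup.closure (Set.range b) = ⊤) (χ : κ → G →* ℤˣ) (u : κ → G)
    (hu : ∀ i j, χ j (u i) = if i = j then -1 else 1)
    (hcard : Fintype.card ι ≤ Fintype.card κ) :
    Subgroup.closure (Set.range u ∪ Set.range (fun v : G => v ^ 2)) = ⊤ := by
  have hrep (t : κ → ℤˣ) :
      ∃ h ∈ Subgroup.closure (Set.range u), MonoidHom.pi χ h = t := by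
    refine ⟨∏ i, u i ^ (if t i = 1 then 0 else 1), Subgroup.prod_mem _ fun i _ =>
      Subgroup.pow_mem _ (Subgroup.subset_closure (Set.mem_range_self i)) _, ?_⟩
    ext j
    have (i : κ) : χ j (u i) ^ (if t i = 1 then 0 else 1) = if i = j then t j else 1 := by
      rw [hu]
      rcases Int.units_eq_one_or (t i) with h | h <;> split_ifs <;> simp_all
    rw [MonoidHom.pi_apply, map_prod]
    simp only [map_pow, this, Finset.prod_ite_eq', Finset.mem_univ, if_true]
  rw [eq_top_iff]
  intro x _
  obtain ⟨h, hh, hχ⟩ := hrep (MonoidHom.pi χ x)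
  obtain ⟨v, hv⟩ := isSquare_of_map_eq_one b hb (MonoidHom.pi χ)
    (fun t => (hrep t).imp fun _ h => h.2) hcard (x := h⁻¹ * x) (by rw [map_mul, map_inv, hχ]; simp)
  rw [← mul_inv_cancel_left h x, hv]
  refine Subgroup.mul_mem _ (Subgroup.closure_mono Set.subset_union_left hh)
    (Subgroup.subset_closure (Or.inr ⟨v, sq v⟩))

theorem exists_generators (K : Type*) [Field K] [NumberField K]
    (h : Odd (Module.finrank ℚ K)) :
    ∃ b : Option (Fin (Units.rank K)) → (𝓞 K)ˣ, Subgroup.closure (Set.range b) = ⊤ := by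
  refine ⟨fun i => i.elim (-1) (Units.fundSystem K), ?_⟩
  rw [eq_top_iff, ← Units.closure_fundSystem_sup_torsion_eq_top, sup_le_iff]
  constructor
  · apply Subgroup.closure_mono
    rintro _ ⟨i, rfl⟩
    exact ⟨some i, rfl⟩
  · intro x hx
    have : x = 1 ∨ x = -1 := by
      simpa [Subtype.ext_iff] using Units.torsion_eq_one_or_neg_one_of_odd_finrank h ⟨x, hx⟩
    rcases this with rfl | rfl
    · exact one_mem _
    · exact Subgroup.subset_closure ⟨none, rfl⟩

theorem PadicInt.exists_root_of_simple_root (q : ℕ) [Fact q.Prime] (F : ℤ[X]) (a : ℤ)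
    (h₀ : (q : ℤ) ∣ F.eval a) (h₁ : ¬ (q : ℤ) ∣ F.derivative.eval a) :
    ∃ z : ℤ_[q], aeval z F = 0 ∧ PadicInt.toZMod z = a := by
  have haeval (G : ℤ[X]) : aeval (a : ℤ_[q]) G = (G.eval a : ℤ) := by
    simpa using aeval_algebraMap_apply ℤ_[q] a G
  have hnorm : ‖aeval (a : ℤ_[q]) F.derivative‖ = 1 := by
    rw [haeval]
    exact le_antisymm (PadicInt.norm_le_one _)
      (not_lt.1 fun h => h₁ ((PadicInt.norm_int_lt_one_iff_dvd _).1 h))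
  obtain ⟨z, hz, hza, -⟩ := hensels_lemma (p := q) (F := F) (a := (a : ℤ_[q])) (by
    rw [hnorm, haeval, one_pow]
    exact (PadicInt.norm_int_lt_one_iff_dvd _).2 h₀)
  refine ⟨z, hz, ?_⟩
  have : z - a ∈ RingHom.ker (PadicInt.toZMod : ℤ_[q] →+* ZMod q) := by
    rw [PadicInt.ker_toZMod, IsLocalRing.mem_maximalIdeal, PadicInt.mem_nonunits]
    rwa [hnorm] at hza
  rw [RingHom.mem_ker, map_sub, map_intCast, sub_eq_zero] at this
  exact this

theorem exists_ringHom_zmod {F : ℤ[X]} {P : ℚ[X]} (hP : F.map (Int.castRingHom ℚ) = P)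
    {K : Type*} [Field K] [NumberField K] (e : K ≃ₐ[ℚ] AdjoinRoot P) {θ : K}
    (hθ : e θ = AdjoinRoot.root P) (q : ℕ) [Fact q.Prime] (a : ℤ)
    (h₀ : (q : ℤ) ∣ F.eval a) (h₁ : ¬ (q : ℤ) ∣ F.derivative.eval a) :
    ∃ ψ : 𝓞 K →+* ZMod q, ∀ (x : 𝓞 K) (g : ℤ[X]), (x : K) = aeval θ g → ψ x = g.eval a := by
  obtain ⟨z, hz, hza⟩ := PadicInt.exists_root_of_simple_root q F a h₀ h₁
  have hroot : eval₂ (algebraMap ℚ ℚ_[q]) (z : ℚ_[q]) P = 0 := by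
    rw [← hP, eval₂_map, RingHom.ext_int ((algebraMap ℚ ℚ_[q]).comp _) (algebraMap ℤ ℚ_[q])]
    exact (aeval_algebraMap_apply ℚ_[q] z F).trans (by rw [hz, map_zero])
  let φ : K →+* ℚ_[q] := (AdjoinRoot.lift _ _ hroot).comp (e : K →+* AdjoinRoot P)
  have hφ : φ θ = z := by simp [φ, hθ]
  have hint (x : 𝓞 K) : φ x ∈ PadicInt.subring q := by
    obtain ⟨y, hy⟩ := IsIntegrallyClosed.isIntegral_iff (R := ℤ_[q]).1
      (((RingOfIntegers.isIntegral_coe x).map (φ.toIntAlgHom)).tower_top (A := ℤ_[q]))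
    exact (show φ x = y from hy.symm) ▸ y.2
  let ρ : 𝓞 K →+* ℤ_[q] := (φ.comp (algebraMap (𝓞 K) K)).codRestrict (PadicInt.subring q) hint
  refine ⟨PadicInt.toZMod.comp ρ, fun x g hx => ?_⟩
  have : ρ x = aeval z g := by
    apply Subtype.ext
    change φ x = algebraMap ℤ_[q] ℚ_[q] _
    rw [← aeval_algebraMap_apply, hx, ← RingHom.toIntAlgHom_apply φ, ← aeval_algHom_apply]
    simp [hφ]
  rw [RingHom.comp_apply, this, ← RingHom.toIntAlgHom_apply PadicInt.toZMod, ← aeval_algHom_apply]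
  simp only [RingHom.toIntAlgHom_apply, hza]
  simpa using aeval_algebraMap_apply (ZMod q) a g

theorem exists_quadratic_character {F : ℤ[X]} {P : ℚ[X]} (hP : F.map (Int.castRingHom ℚ) = P)
    {K : Type*} [Field K] [NumberField K] (e : K ≃ₐ[ℚ] AdjoinRoot P) {θ : K}
    (hθ : e θ = AdjoinRoot.root P) (q : ℕ) [Fact q.Prime] (a : ℤ)
    (h₀ : (q : ℤ) ∣ F.eval a) (h₁ : ¬ (q : ℤ) ∣ F.derivative.eval a) :
    ∃ χ : (𝓞 K)ˣ →* ℤˣ, ∀ (u : (𝓞 K)ˣ) (m : ℤ) (g : ℤ[X]), ¬ (q : ℤ) ∣ m →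
      (m : K) * ((u : 𝓞 K) : K) = aeval θ g → (χ u : ℤ) = legendreSym q (m * g.eval a) := by
  obtain ⟨ψ, hψ⟩ := exists_ringHom_zmod hP e hθ q a h₀ h₁
  refine ⟨(quadraticChar (ZMod q)).toUnitHom.comp (Units.map ψ), fun u m g hm h => ?_⟩
  have hm' : (m : ZMod q) ≠ 0 := by rwa [Ne, ZMod.intCast_zmod_eq_zero_iff_dvd]
  have := hψ (m * u) g (by simpa using h)
  rw [map_mul, map_intCast] at this
  rw [legendreSym, Int.cast_mul, ← this, ← mul_assoc, map_mul, map_mul, ← sq,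
    quadraticChar_sq_one hm', one_mul]
  simp

theorem finrank_eq_natDegree {P : ℚ[X]} (hP : P ≠ 0) {K : Type*} [Field K] [NumberField K]
    (e : K ≃ₐ[ℚ] AdjoinRoot P) : Module.finrank ℚ K = P.natDegree := by
  rw [e.toLinearEquiv.finrank_eq, (AdjoinRoot.powerBasis hP).finrank, AdjoinRoot.powerBasis_dim]

theorem nrRealPlaces_le_card {P : ℚ[X]} {K : Type*} [Field K] [NumberField K]
    (e : K ≃ₐ[ℚ] AdjoinRoot P) {ι : Type*} [Fintype ι] (k : ℝ → ι)
    (hk : ∀ x y : ℝ, aeval x P = 0 → aeval y P = 0 → k x = k y → x = y) :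
    InfinitePlace.nrRealPlaces K ≤ Fintype.card ι := by
  classical
  set θ := e.symm (AdjoinRoot.root P) with hθ
  have hθ₀ : aeval θ P = 0 := by
    rw [hθ, aeval_algHom_apply]
    simp
  let r : {w : InfinitePlace K // w.IsReal} → K →ₐ[ℚ] ℝ :=
    fun w => (InfinitePlace.embedding_of_isReal w.2).toRatAlgHom
  refine Fintype.card_le_of_injective (fun w => k (r w θ)) fun w v hwv => ?_
  have hroot (w) : aeval (r w θ) P = 0 := by rw [aeval_algHom_apply, hθ₀, map_zero]
  have h := hk _ _ (hroot w) (hroot v) hwv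
  have hr : r w = r v := by
    have : (r w).comp e.symm.toAlgHom = (r v).comp e.symm.toAlgHom := AdjoinRoot.algHom_ext h
    ext x
    simpa using DFunLike.congr_fun this (e x)
  apply Subtype.ext
  rw [← InfinitePlace.mk_embedding w.1, ← InfinitePlace.mk_embedding v.1]
  congr 1
  ext x
  rw [← InfinitePlace.embedding_of_isReal_apply w.2, ← InfinitePlace.embedding_of_isReal_apply v.2]
  exact congrArg _ (DFunLike.congr_fun hr x)

theorem eq_of_neg_roots {x y : ℝ} (hx : x < 0) (hy : y < 0)
    (h₁ : x ^ 7 - 23 * x ^ 4 - 28 * x ^ 3 - 33 * x ^ 2 - 17 * x + 1 = 0)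
    (h₂ : y ^ 7 - 23 * y ^ 4 - 28 * y ^ 3 - 33 * y ^ 2 - 17 * y + 1 = 0) : x = y := by
  wlog hxy : x < y generalizing x y
  · rcases lt_trichotomy x y with h | h | h
    exacts [absurd h hxy, h, (this hy hx h₂ h₁ h).symm]
  exfalso
  have hxy' : 0 < x * y := mul_pos_of_neg_of_neg hx hy
  have e₁ : (y - x) * (x * y * (x ^ 5 + x ^ 4 * y + x ^ 3 * y ^ 2 + x ^ 2 * y ^ 3 + x * y ^ 4 + y ^ 5
      - 23 * (x ^ 2 + x * y + y ^ 2) - 28 * (x + y) - 33) - 1) = 0 := by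
    linear_combination x * h₂ - y * h₁
  have e₂ : x ^ 5 + x ^ 4 * y + x ^ 3 * y ^ 2 + x ^ 2 * y ^ 3 + x * y ^ 4 + y ^ 5 < 0 := by
    have : x ^ 5 + x ^ 4 * y + x ^ 3 * y ^ 2 + x ^ 2 * y ^ 3 + x * y ^ 4 + y ^ 5
      = (x + y) * (x ^ 4 + (x * y) ^ 2 + y ^ 4) := by ring
    rw [this]
    exact mul_neg_of_neg_of_pos (by linarith) (by positivity)
  have e₃ : 0 < 23 * (x ^ 2 + x * y + y ^ 2) + 28 * (x + y) + 33 := by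
    nlinarith [sq_nonneg (x - y), sq_nonneg (69 * (x + y) + 56)]
  rcases mul_eq_zero.1 e₁ with h | h
  · linarith
  · nlinarith

theorem eq_of_roots_Icc {x y : ℝ} (hx : 0 ≤ x) (hx' : x ≤ 1) (hy : 0 ≤ y) (hy' : y ≤ 1)
    (h₁ : x ^ 7 - 23 * x ^ 4 - 28 * x ^ 3 - 33 * x ^ 2 - 17 * x + 1 = 0)
    (h₂ : y ^ 7 - 23 * y ^ 4 - 28 * y ^ 3 - 33 * y ^ 2 - 17 * y + 1 = 0) : x = y := by
  wlog hxy : x < y generalizing x y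
  · rcases lt_trichotomy x y with h | h | h
    exacts [absurd h hxy, h, (this hy hy' hx hx' h₂ h₁ h).symm]
  exfalso
  have a₁ : y ^ 2 - x ^ 2 ≥ 0 := sub_nonneg.2 (by gcongr)
  have a₂ : y ^ 3 - x ^ 3 ≥ 0 := sub_nonneg.2 (by gcongr)
  have a₃ : y ^ 4 - x ^ 4 ≥ 0 := sub_nonneg.2 (by gcongr)
  have b : y ^ 7 - x ^ 7 ≤ 7 * (y - x) := by
    have hp (i j : ℕ) : x ^ i * y ^ j ≤ 1 :=
      mul_le_one₀ (pow_le_one₀ hx hx') (by positivity) (pow_le_one₀ hy hy')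
    have : y ^ 7 - x ^ 7 = (y - x) * (x ^ 6 * y ^ 0 + x ^ 5 * y ^ 1 + x ^ 4 * y ^ 2 + x ^ 3 * y ^ 3
      + x ^ 2 * y ^ 4 + x ^ 1 * y ^ 5 + x ^ 0 * y ^ 6) := by ring
    rw [this, mul_comm]
    refine mul_le_mul_of_nonneg_right ?_ (by linarith)
    linarith [hp 6 0, hp 5 1, hp 4 2, hp 3 3, hp 2 4, hp 1 5, hp 0 6]
  linarith

theorem eq_of_one_le_roots {x y : ℝ} (hx : 1 ≤ x) (hy : 1 ≤ y)
    (h₁ : x ^ 7 - 23 * x ^ 4 - 28 * x ^ 3 - 33 * x ^ 2 - 17 * x + 1 = 0)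
    (h₂ : y ^ 7 - 23 * y ^ 4 - 28 * y ^ 3 - 33 * y ^ 2 - 17 * y + 1 = 0) : x = y := by
  wlog hxy : x < y generalizing x y
  · rcases lt_trichotomy x y with h | h | h
    exacts [absurd h hxy, h, (this hy hx h₂ h₁ h).symm]
  exfalso
  have hx₀ : 0 < x := by linarith
  have hd : 0 < y - x := by linarith
  have a₁ : 0 < y ^ 2 - x ^ 2 := sub_pos.2 (by gcongr)
  have a₂ : 0 < y ^ 3 - x ^ 3 := sub_pos.2 (by gcongr)
  have e : x ^ 4 * y ^ 4 * (y ^ 3 - x ^ 3) + 28 * (x ^ 3 * y ^ 3 * (y - x))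
      + 33 * (x ^ 2 * y ^ 2 * (y ^ 2 - x ^ 2))
      + (17 * (x * y) * (y ^ 3 - x ^ 3) - (y ^ 4 - x ^ 4)) = 0 := by
    linear_combination x ^ 4 * h₂ - y ^ 4 * h₁
  have b : 0 ≤ 17 * (x * y) * (y ^ 3 - x ^ 3) - (y ^ 4 - x ^ 4) := by
    have : 17 * (x * y) * (y ^ 3 - x ^ 3) - (y ^ 4 - x ^ 4) =
      (y - x) * (17 * (x * y) * (y ^ 2 + x * y + x ^ 2) - (x + y) * (x ^ 2 + y ^ 2)) := by ring
    rw [this]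
    refine mul_nonneg hd.le ?_
    have hs : x + y ≤ 2 * (x * y) := by nlinarith
    have ht : x ^ 2 + y ^ 2 ≤ y ^ 2 + x * y + x ^ 2 := by nlinarith
    have := mul_le_mul hs ht (by positivity) (by positivity)
    have : 0 ≤ x * y * (y ^ 2 + x * y + x ^ 2) := by positivity
    linarith
  have : 0 < x ^ 4 * y ^ 4 * (y ^ 3 - x ^ 3) := by positivity
  have : 0 < x ^ 3 * y ^ 3 * (y - x) := by positivity
  have : 0 < x ^ 2 * y ^ 2 * (y ^ 2 - x ^ 2) := by positivity
  linarith

/-- A form of `pQ` with integer coefficients. -/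
noncomputable def pZ : ℤ[X] :=
  X ^ 7 - 23 * X ^ 4 - 28 * X ^ 3 - 33 * X ^ 2 - 17 * X + 1

theorem pZ_map : pZ.map (Int.castRingHom ℚ) = pQ := by
  simp [pZ, pQ]

theorem pQ_natDegree : pQ.natDegree = 7 := by
  rw [pQ]
  compute_degree!

theorem aeval_pQ (x : ℝ) :
    aeval x pQ = x ^ 7 - 23 * x ^ 4 - 28 * x ^ 3 - 33 * x ^ 2 - 17 * x + 1 := by
  simp [pQ, map_ofNat]

theorem nrRealPlaces_le_three {K : Type*} [Field K] [NumberField K]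
    (e : K ≃ₐ[ℚ] AdjoinRoot pQ) : InfinitePlace.nrRealPlaces K ≤ 3 := by
  refine nrRealPlaces_le_card e
    (fun x => if x < 0 then (0 : Fin 3) else if x ≤ 1 then 1 else 2) fun x y hx hy h => ?_
  rw [aeval_pQ] at hx hy
  split_ifs at h with h₁ h₂ h₃ h₄ h₅ h₆ <;> first
    | exact eq_of_neg_roots (by assumption) (by assumption) hx hy
    | exact eq_of_roots_Icc (by linarith) (by assumption) (by linarith) (by assumption) hx hy
    | exact eq_of_one_le_roots (by linarith) (by linarith) hx hy
    | exact absurd h (by decide)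

theorem finrank_eq_seven {K : Type*} [Field K] [NumberField K]
    (e : K ≃ₐ[ℚ] AdjoinRoot pQ) : Module.finrank ℚ K = 7 := by
  rw [finrank_eq_natDegree (ne_zero_of_natDegree_gt (n := 0) (by simp [pQ_natDegree])) e,
    pQ_natDegree]

theorem rank_le_four {K : Type*} [Field K] [NumberField K]
    (e : K ≃ₐ[ℚ] AdjoinRoot pQ) : Units.rank K ≤ 4 := by
  have h₁ := InfinitePlace.card_add_two_mul_card_eq_rank K
  have h₂ := nrRealPlaces_le_three e
  have h₃ := finrank_eq_seven e
  rw [Units.rank, InfinitePlace.card_eq_nrRealPlaces_add_nrComplexPlaces]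
  omega

theorem exists_pZ_character {K : Type*} [Field K] [NumberField K] (e : K ≃ₐ[ℚ] AdjoinRoot pQ)
    {θ : K} (hθ : e θ = AdjoinRoot.root pQ) (q : ℕ) [Fact q.Prime] (a : ℤ)
    (h₀ : (q : ℤ) ∣ a ^ 7 - 23 * a ^ 4 - 28 * a ^ 3 - 33 * a ^ 2 - 17 * a + 1)
    (h₁ : ¬ (q : ℤ) ∣ 7 * a ^ 6 - 92 * a ^ 3 - 84 * a ^ 2 - 66 * a - 17) :
    ∃ χ : (𝓞 K)ˣ →* ℤˣ, ∀ (u : (𝓞 K)ˣ) (m : ℤ) (g : ℤ[X]), ¬ (q : ℤ) ∣ m →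
      (m : K) * ((u : 𝓞 K) : K) = aeval θ g → (χ u : ℤ) = legendreSym q (m * g.eval a) := by
  refine exists_quadratic_character pZ_map e hθ q a (by simpa [pZ] using h₀) ?_
  convert h₁ using 2
  simp [pZ]
  ring

/-- In the number field `K = ℚ[X]/(p(X))` with `θ` the image of `X`, the units
`f₁(θ), f₂(θ), f₃(θ), f₄(θ)` together with `−1` generate the unit group
`𝒰 = 𝒪_K^×` modulo squares. -/
theorem units_generate_mod_squares
    (K : Type) [Field K] [NumberField K] (e : K ≃ₐ[ℚ] AdjoinRoot pQ)
    (θ : K) (hθ : e θ = AdjoinRoot.root pQ)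
    (u₁ u₂ u₃ u₄ : (𝓞 K)ˣ)
    (h₁ : ((u₁ : 𝓞 K) : K) = Polynomial.aeval θ f₁)
    (h₂ : ((u₂ : 𝓞 K) : K) = Polynomial.aeval θ f₂)
    (h₃ : ((u₃ : 𝓞 K) : K) = Polynomial.aeval θ f₃)
    (h₄ : ((u₄ : 𝓞 K) : K) = Polynomial.aeval θ f₄) :
    Subgroup.closure (({u₁, u₂, u₃, u₄, -1} : Set (𝓞 K)ˣ)
        ∪ Set.range (fun v : (𝓞 K)ˣ => v ^ 2)) = ⊤ := by
  have : Fact (Nat.Prime 17) := ⟨by norm_num⟩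
  have : Fact (Nat.Prime 29) := ⟨by norm_num⟩
  have : Fact (Nat.Prime 41) := ⟨by norm_num⟩
  have : Fact (Nat.Prime 79) := ⟨by norm_num⟩
  have : Fact (Nat.Prime 149) := ⟨by norm_num⟩
  obtain ⟨χ₁, hχ₁⟩ := exists_pZ_character e hθ 29 19 (by norm_num) (by norm_num)
  obtain ⟨χ₂, hχ₂⟩ := exists_pZ_character e hθ 41 39 (by norm_num) (by norm_num)
  obtain ⟨χ₃, hχ₃⟩ := exists_pZ_character e hθ 17 4 (by norm_num) (by norm_num)
  obtain ⟨χ₄, hχ₄⟩ := exists_pZ_character e hθ 149 127 (by norm_num) (by norm_num)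
  obtain ⟨χ₅, hχ₅⟩ := exists_pZ_character e hθ 79 72 (by norm_num) (by norm_num)
  let u : Fin 5 → (𝓞 K)ˣ := ![u₁, u₂, u₃, u₄, -1]
  let g : Fin 5 → ℤ[X] := ![3 * X,
    38 * X ^ 6 + 2 * X ^ 5 - X ^ 4 - 872 * X ^ 3 - 1108 * X ^ 2 - 1309 * X - 713,
    842 * X ^ 6 + 5072 * X ^ 5 - 6847 * X ^ 4 - 46061 * X ^ 3 - 34930 * X ^ 2 - 52216 * X + 2878,
    4260971 * X ^ 6 - 3124108 * X ^ 5 + 2290532 * X ^ 4 - 99681839 * X ^ 3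
      - 46221667 * X ^ 2 - 106722952 * X + 5811547,
    -3]
  have hug (i : Fin 5) : ((3 : ℤ) : K) * ((u i : 𝓞 K) : K) = aeval θ (g i) := by
    fin_cases i
    · simp [u, g, h₁, f₁, map_ofNat]
    · simp [u, g, h₂, f₂, map_ofNat]
    · simp [u, g, h₃, f₃, map_ofNat]
    · simp [u, g, h₄, f₄, map_ofNat]
    · simp [u, g, map_ofNat]
  obtain ⟨b, hb⟩ := exists_generators K (by rw [finrank_eq_seven e]; decide)
  have key := closure_union_squares_eq_top b hb ![χ₁, χ₂, χ₃, χ₄, χ₅] u (fun i j => by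
    apply Units.ext
    fin_cases j
    · refine (hχ₁ (u i) 3 (g i) (by norm_num) (hug i)).trans ?_
      fin_cases i <;> norm_num [g]
    · refine (hχ₂ (u i) 3 (g i) (by norm_num) (hug i)).trans ?_
      fin_cases i <;> norm_num [g]
    · refine (hχ₃ (u i) 3 (g i) (by norm_num) (hug i)).trans ?_
      fin_cases i <;> norm_num [g]
    · refine (hχ₄ (u i) 3 (g i) (by norm_num) (hug i)).trans ?_
      fin_cases i <;> norm_num [g]
    · refine (hχ₅ (u i) 3 (g i) (by norm_num) (hug i)).trans ?_
      fin_cases i <;> norm_num [g]) (by simpa using Nat.lt_succ_of_le (rank_le_four e))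
  have hu : Set.range u = {u₁, u₂, u₃, u₄, -1} := by
    ext x
    simp [u]
    tauto
  rw [← hu]
  exact key
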